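/- arXiv:2505.08146 — 6 statements merged into one kernel-verified Lean document; each statement's English description precedes it below -/
import Mathlib

section
/- Let Z = ∑_{i=1}^d s(i) x_i be the AMS sketch of x ∈ ℝ^d. Then E[Z²] = ‖x‖₂² and Var(Z²) ≤ 2 ‖x‖₂⁴. -/
open Finset MeasureTheory ProbabilityTheory

/-- The fourth mixed moments of sign variables with vanishing second and fourth moments over
distinct indices agree with those of independent Rademacher variables. -/
theorem integral_four_signs_eq {ι Ω : Type*} [DecidableEq ι] [MeasurableSpace Ω]
    (μ : Measure Ω) [IsProbabilityMeasure μ] (s : ι → Ω → ℝ)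
    (hsq : ∀ i ω, s i ω * s i ω = 1)
    (h2 : ∀ i j, i ≠ j → ∫ ω, s i ω * s j ω ∂μ = 0)
    (h4 : ∀ i j k l, i ≠ j → i ≠ k → i ≠ l → j ≠ k → j ≠ l → k ≠ l →
      ∫ ω, s i ω * s j ω * s k ω * s l ω ∂μ = 0) (i j k l : ι) :
    ∫ ω, s i ω * s j ω * s k ω * s l ω ∂μ =
      (if i = j then if k = l then 1 else 0 else 0) +
      (if i = k then if j = l then 1 else 0 else 0) +
      (if i = l then if j = k then 1 else 0 else 0) -
      2 * (if i = j then if i = k then if i = l then 1 else 0 else 0 else 0) := by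
  have h2' (a b : ι) : ∫ ω, s a ω * s b ω ∂μ = if a = b then 1 else 0 := by
    split_ifs with h
    · subst h
      simp [hsq]
    · exact h2 a b h
  by_cases hij : i = j
  · subst hij
    have e : ∀ ω, s i ω * s i ω * s k ω * s l ω = s k ω * s l ω := fun ω => by
      rw [hsq, one_mul]
    simp only [e, h2']
    grind
  by_cases hik : i = k
  · subst hik
    have e : ∀ ω, s i ω * s j ω * s i ω * s l ω = s j ω * s l ω := fun ω => by
      linear_combination (s j ω * s l ω) * hsq i ω
    simp only [e, h2']
    grind
  by_cases hil : i = l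
  · subst hil
    have e : ∀ ω, s i ω * s j ω * s k ω * s i ω = s j ω * s k ω := fun ω => by
      linear_combination (s j ω * s k ω) * hsq i ω
    simp only [e, h2']
    grind
  by_cases hjk : j = k
  · subst hjk
    have e : ∀ ω, s i ω * s j ω * s j ω * s l ω = s i ω * s l ω := fun ω => by
      linear_combination (s i ω * s l ω) * hsq j ω
    simp only [e, h2']
    grind
  by_cases hjl : j = l
  · subst hjl
    have e : ∀ ω, s i ω * s j ω * s k ω * s j ω = s i ω * s k ω := fun ω => by
      linear_combination (s i ω * s k ω) * hsq j ω
    simp only [e, h2']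
    grind
  by_cases hkl : k = l
  · subst hkl
    have e : ∀ ω, s i ω * s j ω * s k ω * s k ω = s i ω * s j ω := fun ω => by
      linear_combination (s i ω * s j ω) * hsq k ω
    simp only [e, h2']
    grind
  rw [h4 i j k l hij hik hil hjk hjl hkl]
  simp [hij, hik, hil]

/-- **AMS sketch moments** (Alon–Matias–Szegedy). If `Z = ∑ i, s i * x i` is the
AMS sketch of `x ∈ ℝ^d`, where the signs `s i` have vanishing mixed moments up to
order 4 (as when drawn from a 4-wise independent family), then `E[Z²] = ‖x‖₂²`
and `Var(Z²) ≤ 2‖x‖₂⁴`. -/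
theorem ams_sketch_moments {Ω : Type*} [MeasureSpace Ω]
    [IsProbabilityMeasure (ℙ : Measure Ω)]
    (d : ℕ) (x : Fin d → ℝ) (s : Fin d → Ω → ℝ)
    (hmeas : ∀ i, Measurable (s i))
    (hsign : ∀ i ω, s i ω = 1 ∨ s i ω = -1)
    (h1 : ∀ i, 𝔼[s i] = 0)
    (h2 : ∀ i j, i ≠ j → 𝔼[fun ω => s i ω * s j ω] = 0)
    (h3 : ∀ i j k, i ≠ j → i ≠ k → j ≠ k →
      𝔼[fun ω => s i ω * s j ω * s k ω] = 0)
    (h4 : ∀ i j k l, i ≠ j → i ≠ k → i ≠ l → j ≠ k → j ≠ l → k ≠ l →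
      𝔼[fun ω => s i ω * s j ω * s k ω * s l ω] = 0) :
    𝔼[fun ω => (∑ i : Fin d, s i ω * x i) ^ 2] = ∑ i : Fin d, x i ^ 2 ∧
    Var[fun ω => (∑ i : Fin d, s i ω * x i) ^ 2] ≤
      2 * (∑ i : Fin d, x i ^ 2) ^ 2 := by
  have hsq (i : Fin d) (ω : Ω) : s i ω * s i ω = 1 := by
    rcases hsign i ω with h | h <;> simp [h]
  have habs (i : Fin d) (ω : Ω) : |s i ω| = 1 := by
    rcases hsign i ω with h | h <;> simp [h]
  have int2 (i j : Fin d) : Integrable (fun ω => s i ω * s j ω) (ℙ : Measure Ω) :=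
    Integrable.of_bound ((hmeas i).mul (hmeas j)).aestronglyMeasurable 1
      (.of_forall fun ω => by simp [habs])
  have int4 (i j k l : Fin d) :
      Integrable (fun ω => s i ω * s j ω * s k ω * s l ω) (ℙ : Measure Ω) :=
    Integrable.of_bound
      ((((hmeas i).mul (hmeas j)).mul (hmeas k)).mul (hmeas l)).aestronglyMeasurable 1
      (.of_forall fun ω => by simp [habs])
  have exp2 (ω : Ω) : (∑ i, s i ω * x i) ^ 2 =
      ∑ i, ∑ j, x i * x j * (s i ω * s j ω) := by
    rw [sq, sum_mul_sum]
    exact sum_congr rfl fun i _ => sum_congr rfl fun j _ => by ring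
  have exp4 (ω : Ω) : ((∑ i, s i ω * x i) ^ 2) ^ 2 =
      ∑ i, ∑ j, ∑ k, ∑ l, x i * x j * x k * x l * (s i ω * s j ω * s k ω * s l ω) := by
    have e (i j k l : Fin d) : x i * x j * x k * x l * (s i ω * s j ω * s k ω * s l ω) =
        (s i ω * x i) * (s j ω * x j) * (s k ω * x k) * (s l ω * x l) := by ring
    simp only [e, ← mul_sum, ← sum_mul]
    ring
  have mean : 𝔼[fun ω => (∑ i : Fin d, s i ω * x i) ^ 2] = ∑ i : Fin d, x i ^ 2 := by
    have m2 (i j : Fin d) : ∫ ω, s i ω * s j ω = if i = j then 1 else 0 := by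
      split_ifs with h
      · subst h
        simp [hsq]
      · exact h2 i j h
    simp only [exp2]
    rw [integral_finsetSum _ fun i _ => integrable_finsetSum _ fun j _ =>
      (int2 i j).const_mul _]
    refine sum_congr rfl fun i _ => ?_
    rw [integral_finsetSum _ fun j _ => (int2 i j).const_mul _]
    simp [integral_const_mul, m2, sq]
  have int_l (i j k l : Fin d) := (int4 i j k l).const_mul (x i * x j * x k * x l)
  have int_k (i j k : Fin d) := integrable_finsetSum univ fun l _ => int_l i j k l
  have int_j (i j : Fin d) := integrable_finsetSum univ fun k _ => int_k i j k
  have int_i (i : Fin d) := integrable_finsetSum univ fun j _ => int_j i j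
  have fourth : 𝔼[fun ω => ((∑ i : Fin d, s i ω * x i) ^ 2) ^ 2] =
      3 * (∑ i : Fin d, x i ^ 2) ^ 2 - 2 * ∑ i : Fin d, x i ^ 4 := by
    have e : ∫ ω, ((∑ i : Fin d, s i ω * x i) ^ 2) ^ 2 = ∑ i, ∑ j, ∑ k, ∑ l,
        x i * x j * x k * x l * ∫ ω, s i ω * s j ω * s k ω * s l ω := by
      simp only [exp4]
      rw [integral_finsetSum _ fun i _ => int_i i]
      refine sum_congr rfl fun i _ => ?_
      rw [integral_finsetSum _ fun j _ => int_j i j]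
      refine sum_congr rfl fun j _ => ?_
      rw [integral_finsetSum _ fun k _ => int_k i j k]
      refine sum_congr rfl fun k _ => ?_
      rw [integral_finsetSum _ fun l _ => int_l i j k l]
      exact sum_congr rfl fun l _ => integral_const_mul _ _
    rw [e]
    simp only [integral_four_signs_eq ℙ s hsq h2 h4, mul_sub, mul_add, sum_sub_distrib,
      sum_add_distrib]
    have p1 : ∑ i, ∑ j, ∑ k, ∑ l, x i * x j * x k * x l *
        (if i = j then if k = l then 1 else 0 else 0) = (∑ i, x i ^ 2) ^ 2 := by
      rw [sq, sum_mul_sum]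
      refine sum_congr rfl fun i _ => ?_
      rw [sum_eq_single i (fun j _ h => by simp [h.symm]) (by simp)]
      refine sum_congr rfl fun k _ => ?_
      simp
      ring
    have p2 : ∑ i, ∑ j, ∑ k, ∑ l, x i * x j * x k * x l *
        (if i = k then if j = l then 1 else 0 else 0) = (∑ i, x i ^ 2) ^ 2 := by
      rw [sq, sum_mul_sum]
      refine sum_congr rfl fun i _ => sum_congr rfl fun j _ => ?_
      rw [sum_eq_single i (fun k _ h => by simp [h.symm]) (by simp)]
      simp
      ring
    have p3 : ∑ i, ∑ j, ∑ k, ∑ l, x i * x j * x k * x l *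
        (if i = l then if j = k then 1 else 0 else 0) = (∑ i, x i ^ 2) ^ 2 := by
      rw [sq, sum_mul_sum]
      refine sum_congr rfl fun i _ => sum_congr rfl fun j _ => ?_
      rw [sum_eq_single j (fun k _ h => by simp [h.symm]) (by simp)]
      simp
      ring
    have p4 : ∑ i, ∑ j, ∑ k, ∑ l, x i * x j * x k * x l *
        (2 * if i = j then if i = k then if i = l then 1 else 0 else 0 else 0) =
        2 * ∑ i, x i ^ 4 := by
      rw [mul_sum]
      refine sum_congr rfl fun i _ => ?_
      rw [sum_eq_single i (fun j _ h => by simp [h.symm]) (by simp),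
        sum_eq_single i (fun k _ h => by simp [h.symm]) (by simp)]
      simp
      ring
    rw [p1, p2, p3, p4]
    ring
  refine ⟨mean, ?_⟩
  have hmeasZ : Measurable fun ω => (∑ i : Fin d, s i ω * x i) ^ 2 := by fun_prop
  have hmem : MemLp (fun ω => (∑ i : Fin d, s i ω * x i) ^ 2) 2 (ℙ : Measure Ω) := by
    rw [memLp_two_iff_integrable_sq hmeasZ.aestronglyMeasurable]
    simp only [exp4]
    exact integrable_finsetSum _ fun i _ => int_i i
  have hnonneg : 0 ≤ ∑ i, x i ^ 4 := sum_nonneg fun i _ => by positivity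
  rw [variance_eq_sub hmem, mean]
  simp only [Pi.pow_apply]
  rw [fourth]
  linarith
end

section
/- For any x, y ∈ ℝ^d, the second moment of the product of AMS sketches satisfies the exact identity E[(Z_s(x) · Z_s(y))²] = 2⟨x, y⟩² + ‖x‖₂² ‖y‖₂² − 2 ∑_{i=1}^d x_i² y_i², where Z_s(x) = ∑_{i=1}^d s(i) x_i and Z_s(y) = ∑_{i=1}^d s(i) y_i. -/
open Finset MeasureTheory ProbabilityTheory

/-- Mixed moments of order four of a sign family whose mixed moments of order two and of order
four over distinct indices vanish. -/
theorem integral_four_signs {Ω ι : Type*} [DecidableEq ι] [MeasurableSpace Ω] (μ : Measure Ω)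
    [IsProbabilityMeasure μ] (s : ι → Ω → ℝ)
    (hsign : ∀ i ω, s i ω = 1 ∨ s i ω = -1)
    (h2 : ∀ i j, i ≠ j → ∫ ω, s i ω * s j ω ∂μ = 0)
    (h4 : ∀ i j k l, i ≠ j → i ≠ k → i ≠ l → j ≠ k → j ≠ l → k ≠ l →
      ∫ ω, s i ω * s j ω * s k ω * s l ω ∂μ = 0) (i j k l : ι) :
    ∫ ω, s i ω * s j ω * s k ω * s l ω ∂μ =
      (if i = j then if k = l then 1 else 0 else 0) +
      (if i = k then if j = l then 1 else 0 else 0) +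
      (if i = l then if j = k then 1 else 0 else 0) -
      2 * (if i = j then if i = k then if i = l then 1 else 0 else 0 else 0) := by
  have hsq : ∀ i ω, s i ω * s i ω = 1 := by
    intro i ω
    rcases hsign i ω with h | h <;> simp [h]
  have hpair : ∀ i j, ∫ ω, s i ω * s j ω ∂μ = if i = j then 1 else 0 := by
    intro i j
    split_ifs with h
    · subst h
      simp [hsq]
    · exact h2 i j h
  have hcancel : ∀ i k l (f : Ω → ℝ), (∀ ω, f ω = s i ω * s i ω * (s k ω * s l ω)) →
      ∫ ω, f ω ∂μ = if k = l then 1 else 0 := by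
    intro i k l f hf
    simp only [hf, hsq, one_mul, hpair]
  by_cases hij : i = j
  · subst hij
    rw [hcancel i k l _ fun ω => by ring]
    grind
  by_cases hik : i = k
  · subst hik
    rw [hcancel i j l _ fun ω => by ring]
    grind
  by_cases hil : i = l
  · subst hil
    rw [hcancel i j k _ fun ω => by ring]
    grind
  by_cases hjk : j = k
  · subst hjk
    rw [hcancel j i l _ fun ω => by ring]
    grind
  by_cases hjl : j = l
  · subst hjl
    rw [hcancel j i k _ fun ω => by ring]
    grind
  by_cases hkl : k = l
  · subst hkl
    rw [hcancel k i j _ fun ω => by ring]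
    grind
  rw [h4 i j k l hij hik hil hjk hjl hkl]
  simp [hij, hik, hil]

/-- **Exact second moment of the product of AMS sketches.** With signs having
vanishing mixed moments up to order 4 (4-wise independent sign family),
`E[(Z_s(x)·Z_s(y))²] = 2⟨x,y⟩² + ‖x‖₂²‖y‖₂² − 2 ∑ i, x i² y i²`. -/
theorem ams_sketch_product_second_moment {Ω : Type*} [MeasureSpace Ω]
    [IsProbabilityMeasure (ℙ : Measure Ω)]
    (d : ℕ) (x y : Fin d → ℝ) (s : Fin d → Ω → ℝ)
    (hmeas : ∀ i, Measurable (s i))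
    (hsign : ∀ i ω, s i ω = 1 ∨ s i ω = -1)
    (h1 : ∀ i, 𝔼[s i] = 0)
    (h2 : ∀ i j, i ≠ j → 𝔼[fun ω => s i ω * s j ω] = 0)
    (h3 : ∀ i j k, i ≠ j → i ≠ k → j ≠ k →
      𝔼[fun ω => s i ω * s j ω * s k ω] = 0)
    (h4 : ∀ i j k l, i ≠ j → i ≠ k → i ≠ l → j ≠ k → j ≠ l → k ≠ l →
      𝔼[fun ω => s i ω * s j ω * s k ω * s l ω] = 0) :
    𝔼[fun ω => ((∑ i : Fin d, s i ω * x i) * (∑ i : Fin d, s i ω * y i)) ^ 2] =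
      2 * (∑ i : Fin d, x i * y i) ^ 2 +
        (∑ i : Fin d, x i ^ 2) * (∑ i : Fin d, y i ^ 2) -
        2 * ∑ i : Fin d, x i ^ 2 * y i ^ 2 := by
  have hint : ∀ i j k l, Integrable (fun ω => s i ω * s j ω * s k ω * s l ω) (ℙ : Measure Ω) := by
    intro i j k l
    refine Integrable.of_bound (C := 1) (by fun_prop) (.of_forall fun ω => ?_)
    rcases hsign i ω with hi | hi <;> rcases hsign j ω with hj | hj <;>
      rcases hsign k ω with hk | hk <;> rcases hsign l ω with hl | hl <;>
      simp [hi, hj, hk, hl]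
  have hexpand : ∀ ω, ((∑ i : Fin d, s i ω * x i) * (∑ i : Fin d, s i ω * y i)) ^ 2 =
      ∑ i, ∑ j, ∑ k, ∑ l, s i ω * s j ω * s k ω * s l ω * (x i * y j * x k * y l) := by
    intro ω
    rw [sq, sum_mul_sum, sum_mul]
    refine sum_congr rfl fun i _ => ?_
    rw [sum_mul]
    refine sum_congr rfl fun j _ => ?_
    rw [mul_sum]
    refine sum_congr rfl fun k _ => ?_
    rw [mul_sum]
    exact sum_congr rfl fun l _ => by ring
  have hterm : ∀ i j k l, Integrable
      (fun ω => s i ω * s j ω * s k ω * s l ω * (x i * y j * x k * y l)) (ℙ : Measure Ω) :=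
    fun i j k l => (hint i j k l).mul_const _
  have hmoment : 𝔼[fun ω => ((∑ i : Fin d, s i ω * x i) * (∑ i : Fin d, s i ω * y i)) ^ 2] =
      ∑ i, ∑ j, ∑ k, ∑ l, 𝔼[fun ω => s i ω * s j ω * s k ω * s l ω] *
        (x i * y j * x k * y l) := by
    simp only [hexpand]
    rw [integral_finsetSum _ fun i _ => integrable_finsetSum _ fun j _ =>
      integrable_finsetSum _ fun k _ => integrable_finsetSum _ fun l _ => hterm i j k l]
    refine sum_congr rfl fun i _ => ?_
    rw [integral_finsetSum _ fun j _ => integrable_finsetSum _ fun k _ =>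
      integrable_finsetSum _ fun l _ => hterm i j k l]
    refine sum_congr rfl fun j _ => ?_
    rw [integral_finsetSum _ fun k _ => integrable_finsetSum _ fun l _ => hterm i j k l]
    refine sum_congr rfl fun k _ => ?_
    rw [integral_finsetSum _ fun l _ => hterm i j k l]
    exact sum_congr rfl fun l _ => integral_mul_const _ _
  rw [hmoment]
  simp only [integral_four_signs ℙ s hsign h2 h4]
  simp only [sub_mul, add_mul, sum_sub_distrib, sum_add_distrib, mul_assoc, ite_mul, one_mul,
    zero_mul, ← mul_sum, sum_ite_eq, sum_ite_irrel, sum_const_zero, mem_univ, if_true]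
  have hA : ∑ i, x i * (y i * ∑ k, x k * y k) = (∑ i, x i * y i) ^ 2 := by
    rw [sq, sum_mul]
    exact sum_congr rfl fun i _ => by ring
  have hB : ∑ i, x i * ∑ j, y j * (x i * y j) = (∑ i, x i ^ 2) * ∑ i, y i ^ 2 := by
    rw [sum_mul_sum]
    refine sum_congr rfl fun i _ => ?_
    rw [mul_sum]
    exact sum_congr rfl fun j _ => by ring
  have hC : ∑ i, x i * ∑ j, y j * (x j * y i) = (∑ i, x i * y i) ^ 2 := by
    rw [sq, sum_mul_sum]
    refine sum_congr rfl fun i _ => ?_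
    rw [mul_sum]
    exact sum_congr rfl fun j _ => by ring
  have hD : ∑ i, x i * (y i * (x i * y i)) = ∑ i, x i ^ 2 * y i ^ 2 :=
    sum_congr rfl fun i _ => by ring
  rw [hA, hB, hC, hD]
  ring
end

section
/- The inner product of the Count Sketches of x and y is an unbiased estimator of the inner product of x and y: E[⟨Cx, Cy⟩] = ⟨x, y⟩, where ⟨Cx, Cy⟩ = ∑_{i,j ∈ [d]} x_i y_j s(i) s(j) 𝟙[h(i) = h(j)]. -/
open Finset MeasureTheory ProbabilityTheory

/-- If `S` and `H` are independent, the indicator that two coordinates of `H` agree is uncorrelated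
with the product of the corresponding coordinates of `S`. -/
theorem integral_mul_mul_collision {Ω ι κ : Type*} [MeasurableSpace Ω] [MeasurableSpace κ]
    [DecidableEq κ] [MeasurableEq κ] {μ : Measure Ω} {s : ι → Ω → ℝ} {h : ι → Ω → κ}
    (hs : ∀ i, Measurable (s i)) (hh : ∀ i, Measurable (h i))
    (hindep : IndepFun (fun ω i => s i ω) (fun ω i => h i ω) μ) (i j : ι) :
    ∫ ω, s i ω * s j ω * (if h i ω = h j ω then (1 : ℝ) else 0) ∂μ =
      (∫ ω, s i ω * s j ω ∂μ) * ∫ ω, (if h i ω = h j ω then (1 : ℝ) else 0) ∂μ := by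
  have hprod : Measurable fun f : ι → ℝ => f i * f j := by fun_prop
  have hcoll : Measurable fun g : ι → κ => if g i = g j then (1 : ℝ) else 0 :=
    Measurable.ite (measurableSet_eq_fun (measurable_pi_apply i) (measurable_pi_apply j))
      measurable_const measurable_const
  have hindep' := hindep.comp hprod hcoll
  exact hindep'.integral_fun_mul_eq_mul_integral
    (hprod.comp (measurable_pi_lambda _ hs)).aestronglyMeasurable
    (hcoll.comp (measurable_pi_lambda _ hh)).aestronglyMeasurable

/-- **Count Sketch is unbiased.** With pairwise independent signs `s` and bucket
hashes `h` satisfying `P[h i = h j] = 1/D` for `i ≠ j`, the inner product of the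
Count Sketches of `x` and `y` is an unbiased estimator of `⟨x, y⟩`. -/
theorem count_sketch_unbiased {Ω : Type*} [MeasureSpace Ω]
    [IsProbabilityMeasure (ℙ : Measure Ω)]
    (d D : ℕ) (hd : 1 ≤ d) (hD : 1 ≤ D) (x y : Fin d → ℝ)
    (s : Fin d → Ω → ℝ) (h : Fin d → Ω → Fin D)
    (hsmeas : ∀ i, Measurable (s i))
    (hhmeas : ∀ i, Measurable (h i))
    (hsign : ∀ i ω, s i ω = 1 ∨ s i ω = -1)
    (hs1 : ∀ i, 𝔼[s i] = 0)
    (hs2 : ∀ i j, i ≠ j → 𝔼[fun ω => s i ω * s j ω] = 0)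
    (hh : ∀ i j, i ≠ j → ℙ {ω | h i ω = h j ω} = 1 / D)
    (hindep : IndepFun (fun ω (i : Fin d) => s i ω) (fun ω (i : Fin d) => h i ω) ℙ) :
    𝔼[fun ω => ∑ i : Fin d, ∑ j : Fin d,
        x i * y j * s i ω * s j ω * (if h i ω = h j ω then (1 : ℝ) else 0)] =
      ∑ i : Fin d, x i * y i := by
  have hterm : ∀ i j, Integrable (fun ω =>
      x i * y j * s i ω * s j ω * (if h i ω = h j ω then (1 : ℝ) else 0)) ℙ := by
    intro i j
    refine Integrable.of_bound (C := |x i * y j|) ?_ (ae_of_all _ fun ω => ?_)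
    · exact Measurable.aestronglyMeasurable <|
        ((measurable_const.mul (hsmeas i)).mul (hsmeas j)).mul <|
          Measurable.ite (measurableSet_eq_fun (hhmeas i) (hhmeas j))
            measurable_const measurable_const
    · rcases hsign i ω with hi | hi <;> rcases hsign j ω with hj | hj <;>
        by_cases hij : h i ω = h j ω <;> simp [hi, hj, hij, abs_mul] <;> positivity
  have hsq : ∀ i ω, s i ω * s i ω = 1 := fun i ω => by
    rcases hsign i ω with hi | hi <;> simp [hi]
  rw [integral_finsetSum _ fun i _ => integrable_finsetSum _ fun j _ => hterm i j]
  refine Finset.sum_congr rfl fun i _ => ?_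
  rw [integral_finsetSum _ fun j _ => hterm i j, Finset.sum_eq_single i]
  · simp [mul_assoc, hsq]
  · intro j _ hji
    have hassoc : ∀ ω, x i * y j * s i ω * s j ω * (if h i ω = h j ω then (1 : ℝ) else 0) =
        x i * y j * (s i ω * s j ω * (if h i ω = h j ω then (1 : ℝ) else 0)) :=
      fun ω => by ring
    simp_rw [hassoc]
    rw [integral_const_mul, integral_mul_mul_collision hsmeas hhmeas hindep,
      hs2 i j hji.symm, zero_mul, mul_zero]
  · simp
end

section
/- The inner product of the Count Sketches of x and y satisfies the exact variance identity Var(⟨Cx, Cy⟩) = (1/D) (∑_{i ≠ j} x_i² y_j² + ∑_{i ≠ j} x_i y_i x_j y_j), where ⟨Cx, Cy⟩ = ∑_{i,j ∈ [d]} x_i y_j s(i) s(j) 𝟙[h(i) = h(j)]. -/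
open Finset MeasureTheory ProbabilityTheory

/-- The product of two off-diagonal pairs from a 4-wise independent sign family has mean zero unless
the pairs agree up to order. -/
theorem integral_sign_pair_mul_pair_eq_zero {Ω ι : Type*} [MeasurableSpace Ω] {μ : Measure Ω}
    {s : ι → Ω → ℝ} (hsign : ∀ i ω, s i ω = 1 ∨ s i ω = -1)
    (hs2 : ∀ i j, i ≠ j → ∫ ω, s i ω * s j ω ∂μ = 0)
    (hs4 : ∀ i j k l, i ≠ j → i ≠ k → i ≠ l → j ≠ k → j ≠ l → k ≠ l →
      ∫ ω, s i ω * s j ω * s k ω * s l ω ∂μ = 0)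
    {i j k l : ι} (hij : i ≠ j) (hkl : k ≠ l) (h1 : ¬(i = k ∧ j = l)) (h2 : ¬(i = l ∧ j = k)) :
    ∫ ω, s i ω * s j ω * (s k ω * s l ω) ∂μ = 0 := by
  have hsq : ∀ i ω, s i ω * s i ω = 1 := fun i ω => by
    rcases hsign i ω with h | h <;> simp [h]
  by_cases hik : i = k
  · subst hik
    rw [← hs2 j l (fun e => h1 ⟨rfl, e⟩)]
    congr 1 with ω
    linear_combination s j ω * s l ω * hsq i ω
  by_cases hil : i = l
  · subst hil
    rw [← hs2 j k (fun e => h2 ⟨rfl, e⟩)]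
    congr 1 with ω
    linear_combination s j ω * s k ω * hsq i ω
  by_cases hjk : j = k
  · subst hjk
    rw [← hs2 i l hil]
    congr 1 with ω
    linear_combination s i ω * s l ω * hsq j ω
  by_cases hjl : j = l
  · subst hjl
    rw [← hs2 i k hik]
    congr 1 with ω
    linear_combination s i ω * s k ω * hsq j ω
  rw [← hs4 i j k l hij hik hil hjk hjl hkl]
  congr 1 with ω
  ring

/-- Reindexing a double sum against the Gram matrix of the off-diagonal sketch terms. -/
theorem sum_sum_mul_offDiag_gram {ι : Type*} [Fintype ι] [DecidableEq ι] (a : ι × ι → ℝ) (c : ℝ) :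
    ∑ p, ∑ q, a p * a q * (if p.1 = p.2 then 0 else
        ((if q = p then 1 else 0) + (if q = p.swap then 1 else 0)) * c) =
      c * ∑ p : ι × ι, if p.1 = p.2 then 0 else a p ^ 2 + a p * a p.swap := by
  rw [mul_sum]
  refine sum_congr rfl fun p _ => ?_
  split_ifs with hp
  · simp
  · simp only [add_mul, mul_add, sum_add_distrib, ite_mul, mul_ite, one_mul, zero_mul, mul_zero,
      sum_ite_eq', mem_univ, if_true]
    ring

/-- **Exact variance of the Count Sketch inner product.** With a 4-wise
independent sign family `s`, a pairwise independent bucket family `h` with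
`P[h i = h j] = 1/D` for `i ≠ j`, and the signs independent of the buckets,
`Var(⟨Cx, Cy⟩) = (1/D)(∑_{i ≠ j} x i² y j² + ∑_{i ≠ j} x i y i x j y j)`. -/
theorem count_sketch_variance_eq {Ω : Type*} [MeasureSpace Ω]
    [IsProbabilityMeasure (ℙ : Measure Ω)]
    (d D : ℕ) (hd : 1 ≤ d) (hD : 1 ≤ D) (x y : Fin d → ℝ)
    (s : Fin d → Ω → ℝ) (h : Fin d → Ω → Fin D)
    (hsmeas : ∀ i, Measurable (s i))
    (hhmeas : ∀ i, Measurable (h i))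
    (hsign : ∀ i ω, s i ω = 1 ∨ s i ω = -1)
    (hs1 : ∀ i, 𝔼[s i] = 0)
    (hs2 : ∀ i j, i ≠ j → 𝔼[fun ω => s i ω * s j ω] = 0)
    (hs3 : ∀ i j k, i ≠ j → i ≠ k → j ≠ k →
      𝔼[fun ω => s i ω * s j ω * s k ω] = 0)
    (hs4 : ∀ i j k l, i ≠ j → i ≠ k → i ≠ l → j ≠ k → j ≠ l → k ≠ l →
      𝔼[fun ω => s i ω * s j ω * s k ω * s l ω] = 0)
    (hh : ∀ i j, i ≠ j → ℙ {ω | h i ω = h j ω} = 1 / D)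
    (hindep : IndepFun (fun ω (i : Fin d) => s i ω) (fun ω (i : Fin d) => h i ω) ℙ) :
    Var[fun ω => ∑ i : Fin d, ∑ j : Fin d,
        x i * y j * s i ω * s j ω * (if h i ω = h j ω then (1 : ℝ) else 0)] =
      (1 / D) * ((∑ i : Fin d, ∑ j : Fin d, if i = j then 0 else x i ^ 2 * y j ^ 2) +
        ∑ i : Fin d, ∑ j : Fin d, if i = j then 0 else x i * y i * x j * y j) := by
  classical
  have hsq : ∀ i ω, s i ω * s i ω = 1 := fun i ω => by
    rcases hsign i ω with h | h <;> simp [h]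
  have hfac : ∀ (F : (Fin d → ℝ) → ℝ) (G : (Fin d → Fin D) → ℝ), Measurable F →
      𝔼[fun ω => F (fun i => s i ω) * G (fun i => h i ω)] =
        𝔼[fun ω => F (fun i => s i ω)] * 𝔼[fun ω => G (fun i => h i ω)] := by
    intro F G hF
    have hG : Measurable G := measurable_of_finite G
    exact (hindep.comp hF hG).integral_fun_mul_eq_mul_integral
      (hF.comp (measurable_pi_lambda _ hsmeas)).aestronglyMeasurable
      (hG.comp (measurable_pi_lambda _ hhmeas)).aestronglyMeasurable
  have hcollMeas : ∀ i j, MeasurableSet {ω | h i ω = h j ω} := fun i j =>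
    measurableSet_eq_fun (hhmeas i) (hhmeas j)
  have hcoll : ∀ i j, i ≠ j → 𝔼[fun ω => if h i ω = h j ω then (1 : ℝ) else 0] = 1 / D := by
    intro i j hij
    have := integral_indicator_one (μ := (ℙ : Measure Ω)) (hcollMeas i j)
    rw [measureReal_def, hh i j hij] at this
    simpa [Set.indicator_apply] using this
  let W : Fin d × Fin d → Ω → ℝ := fun p ω =>
    if p.1 = p.2 then 0 else s p.1 ω * s p.2 ω * (if h p.1 ω = h p.2 ω then 1 else 0)
  have hWmeas : ∀ p, Measurable (W p) := by
    intro p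
    by_cases hp : p.1 = p.2
    · simp [W, hp]
    · simp only [W, hp, if_false]
      exact ((hsmeas _).mul (hsmeas _)).mul
        (Measurable.ite (hcollMeas _ _) measurable_const measurable_const)
  have hWLp : ∀ p, MemLp (W p) 2 ℙ := by
    intro p
    refine MemLp.of_bound (hWmeas p).aestronglyMeasurable 1 (ae_of_all _ fun ω => ?_)
    rcases hsign p.1 ω with h1 | h1 <;> rcases hsign p.2 ω with h2 | h2 <;>
      simp only [W, h1, h2] <;> split_ifs <;> norm_num
  have hWmean : ∀ p, 𝔼[W p] = 0 := by
    intro p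
    by_cases hp : p.1 = p.2
    · simp [W, hp]
    · simp only [W, hp, if_false]
      rw [hfac (fun u => u p.1 * u p.2) (fun v => if v p.1 = v p.2 then 1 else 0) (by fun_prop),
        hs2 _ _ hp, zero_mul]
  have hWsq : ∀ p : Fin d × Fin d, p.1 ≠ p.2 → 𝔼[fun ω => W p ω * W p ω] = 1 / D := by
    intro p hp
    rw [← hcoll _ _ hp]
    congr 1 with ω
    simp only [W, hp, if_false]
    split_ifs
    · linear_combination s p.2 ω * s p.2 ω * hsq p.1 ω + hsq p.2 ω
    · simp
  have hWswap : ∀ p, W p.swap = W p := by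
    intro p
    ext ω
    simp only [W, Prod.fst_swap, Prod.snd_swap, eq_comm (a := p.2), eq_comm (a := h p.2 ω),
      mul_comm (s p.2 ω)]
  have hgram : ∀ p q, 𝔼[fun ω => W p ω * W q ω] = if p.1 = p.2 then 0 else
      ((if q = p then 1 else 0) + (if q = p.swap then 1 else 0)) * (1 / D : ℝ) := by
    intro p q
    by_cases hp : p.1 = p.2
    · simp [W, hp]
    have hne : p ≠ p.swap := fun e => hp (congrArg Prod.fst e)
    rw [if_neg hp]
    by_cases hqp : q = p
    · rw [hqp, hWsq p hp, if_pos rfl, if_neg hne]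
      ring
    by_cases hqs : q = p.swap
    · rw [hqs, hWswap, hWsq p hp, if_pos rfl, if_neg hne.symm]
      ring
    rw [if_neg hqp, if_neg hqs, add_zero, zero_mul]
    by_cases hq : q.1 = q.2
    · simp [W, hq]
    have hprod : ∀ ω, W p ω * W q ω = s p.1 ω * s p.2 ω * (s q.1 ω * s q.2 ω) *
        ((if h p.1 ω = h p.2 ω then 1 else 0) * (if h q.1 ω = h q.2 ω then 1 else 0)) := by
      intro ω
      simp only [W, hp, hq, if_false]
      ring
    simp only [hprod]
    rw [hfac (fun u => u p.1 * u p.2 * (u q.1 * u q.2))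
      (fun v => (if v p.1 = v p.2 then 1 else 0) * (if v q.1 = v q.2 then 1 else 0)) (by fun_prop),
      integral_sign_pair_mul_pair_eq_zero hsign hs2 hs4 hp hq
        (fun e => hqp (Prod.ext e.1.symm e.2.symm)) (fun e => hqs (Prod.ext e.2.symm e.1.symm)),
      zero_mul]
  have hdecomp : (fun ω => ∑ i : Fin d, ∑ j : Fin d,
        x i * y j * s i ω * s j ω * (if h i ω = h j ω then (1 : ℝ) else 0)) =
      fun ω => (∑ i, x i * y i) + ∑ p : Fin d × Fin d, x p.1 * y p.2 * W p ω := by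
    ext ω
    rw [Fintype.sum_prod_type, ← sum_add_distrib]
    refine sum_congr rfl fun i _ => ?_
    rw [← sum_ite_eq univ i (fun j => x i * y j) |>.trans (if_pos (mem_univ i)),
      ← sum_add_distrib]
    refine sum_congr rfl fun j _ => ?_
    by_cases hij : i = j
    · subst hij
      simp only [W, if_true]
      linear_combination x i * y i * hsq i ω
    · simp only [W, hij, if_false]
      ring
  have hterm : ∀ p : Fin d × Fin d, MemLp (fun ω => x p.1 * y p.2 * W p ω) 2 ℙ :=
    fun p => (hWLp p).const_mul _
  rw [hdecomp, variance_const_add (memLp_finsetSum _ fun p _ => hterm p).aestronglyMeasurable,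
    variance_fun_sum hterm]
  have hcov : ∀ p q : Fin d × Fin d,
      cov[fun ω => x p.1 * y p.2 * W p ω, fun ω => x q.1 * y q.2 * W q ω; ℙ] =
        x p.1 * y p.2 * (x q.1 * y q.2) * 𝔼[fun ω => W p ω * W q ω] := by
    intro p q
    rw [covariance_const_mul_left, covariance_const_mul_right,
      covariance_eq_sub (hWLp p) (hWLp q), hWmean p, zero_mul, sub_zero, ← mul_assoc]
    rfl
  simp only [hcov, hgram]
  rw [sum_sum_mul_offDiag_gram (fun p => x p.1 * y p.2), Fintype.sum_prod_type, ← sum_add_distrib]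
  congr 1
  refine sum_congr rfl fun i _ => ?_
  rw [← sum_add_distrib]
  refine sum_congr rfl fun j _ => ?_
  split_ifs
  · simp
  · simp only [Prod.fst_swap, Prod.snd_swap]
    ring
end

section
/- The inner product of the Count Sketches of x and y satisfies the variance bound Var(⟨Cx, Cy⟩) ≤ (2/D) ‖x‖₂² ‖y‖₂², where ⟨Cx, Cy⟩ = ∑_{i,j ∈ [d]} x_i y_j s(i) s(j) 𝟙[h(i) = h(j)]. -/
open Finset MeasureTheory ProbabilityTheory

/-- A product of four signs indexed by two pairs `i ≠ j` and `k ≠ l` has expectation zero unless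
the two unordered pairs agree, by 2-wise and 4-wise independence. -/
lemma integral_sign_mul_eq_zero {Ω ι : Type*} [MeasurableSpace Ω] {μ : Measure Ω}
    {s : ι → Ω → ℝ} (hsign : ∀ i ω, s i ω = 1 ∨ s i ω = -1)
    (hs2 : ∀ i j, i ≠ j → ∫ ω, s i ω * s j ω ∂μ = 0)
    (hs4 : ∀ i j k l, i ≠ j → i ≠ k → i ≠ l → j ≠ k → j ≠ l → k ≠ l →
      ∫ ω, s i ω * s j ω * s k ω * s l ω ∂μ = 0)
    {i j k l : ι} (hij : i ≠ j) (hkl : k ≠ l)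
    (h₁ : ¬(k = i ∧ l = j)) (h₂ : ¬(k = j ∧ l = i)) :
    ∫ ω, s i ω * s j ω * s k ω * s l ω ∂μ = 0 := by
  have hsq : ∀ i ω, s i ω * s i ω = 1 := fun i ω => by
    rcases hsign i ω with h | h <;> simp [h]
  by_cases hki : k = i
  · subst hki
    rw [← hs2 j l (fun e => h₁ ⟨rfl, e.symm⟩)]
    congr 1 with ω
    linear_combination (s j ω * s l ω) * hsq k ω
  by_cases hkj : k = j
  · subst hkj
    rw [← hs2 i l (fun e => h₂ ⟨rfl, e.symm⟩)]
    congr 1 with ω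
    linear_combination (s i ω * s l ω) * hsq k ω
  by_cases hli : l = i
  · subst hli
    rw [← hs2 j k (Ne.symm hkj)]
    congr 1 with ω
    linear_combination (s j ω * s k ω) * hsq l ω
  by_cases hlj : l = j
  · subst hlj
    rw [← hs2 i k (Ne.symm hki)]
    congr 1 with ω
    linear_combination (s i ω * s k ω) * hsq l ω
  exact hs4 i j k l hij (Ne.symm hki) (Ne.symm hli) (Ne.symm hkj) (Ne.symm hlj) hkl

/-- The off-diagonal coefficient bound: the pairing of `x i * y j` with itself and with its
transpose is controlled by the product of the squared norms. -/
lemma sum_offDiag_sq_add_mul_swap_le {ι : Type*} [Fintype ι] [DecidableEq ι] (x y : ι → ℝ) :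
    ∑ p ∈ (univ : Finset ι).offDiag,
        ((x p.1 * y p.2) ^ 2 + x p.1 * y p.2 * (x p.2 * y p.1)) ≤
      2 * ((∑ i, x i ^ 2) * ∑ i, y i ^ 2) := by
  calc
    _ ≤ ∑ p ∈ (univ : Finset ι).offDiag,
        ((x p.1 * y p.2) ^ 2 + ((x p.1 * y p.2) ^ 2 + (x p.2 * y p.1) ^ 2) / 2) := by
      gcongr with p
      nlinarith [sq_nonneg (x p.1 * y p.2 - x p.2 * y p.1)]
    _ ≤ ∑ p : ι × ι,
        ((x p.1 * y p.2) ^ 2 + ((x p.1 * y p.2) ^ 2 + (x p.2 * y p.1) ^ 2) / 2) :=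
      sum_le_sum_of_subset_of_nonneg (subset_univ _) fun _ _ _ => by positivity
    _ = 2 * ((∑ i, x i ^ 2) * ∑ i, y i ^ 2) := by
      have h₁ : ∑ p : ι × ι, (x p.1 * y p.2) ^ 2 = (∑ i, x i ^ 2) * ∑ i, y i ^ 2 := by
        simp only [Fintype.sum_prod_type, sum_mul_sum, mul_pow]
      have h₂ : ∑ p : ι × ι, (x p.2 * y p.1) ^ 2 = (∑ i, x i ^ 2) * ∑ i, y i ^ 2 := by
        rw [Fintype.sum_prod_type_right, sum_mul_sum]
        simp only [mul_pow]
      rw [sum_add_distrib, ← sum_div, sum_add_distrib, h₁, h₂]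
      ring

/-- **Variance bound for the Count Sketch inner product.** With a 4-wise
independent sign family `s`, a pairwise independent bucket family `h` with
`P[h i = h j] = 1/D` for `i ≠ j`, and the signs independent of the buckets,
`Var(⟨Cx, Cy⟩) ≤ (2/D) ‖x‖₂² ‖y‖₂²`. -/
theorem count_sketch_variance_le {Ω : Type*} [MeasureSpace Ω]
    [IsProbabilityMeasure (ℙ : Measure Ω)]
    (d D : ℕ) (hd : 1 ≤ d) (hD : 1 ≤ D) (x y : Fin d → ℝ)
    (s : Fin d → Ω → ℝ) (h : Fin d → Ω → Fin D)
    (hsmeas : ∀ i, Measurable (s i))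
    (hhmeas : ∀ i, Measurable (h i))
    (hsign : ∀ i ω, s i ω = 1 ∨ s i ω = -1)
    (hs1 : ∀ i, 𝔼[s i] = 0)
    (hs2 : ∀ i j, i ≠ j → 𝔼[fun ω => s i ω * s j ω] = 0)
    (hs3 : ∀ i j k, i ≠ j → i ≠ k → j ≠ k →
      𝔼[fun ω => s i ω * s j ω * s k ω] = 0)
    (hs4 : ∀ i j k l, i ≠ j → i ≠ k → i ≠ l → j ≠ k → j ≠ l → k ≠ l →
      𝔼[fun ω => s i ω * s j ω * s k ω * s l ω] = 0)
    (hh : ∀ i j, i ≠ j → ℙ {ω | h i ω = h j ω} = 1 / D)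
    (hindep : IndepFun (fun ω (i : Fin d) => s i ω) (fun ω (i : Fin d) => h i ω) ℙ) :
    Var[fun ω => ∑ i : Fin d, ∑ j : Fin d,
        x i * y j * s i ω * s j ω * (if h i ω = h j ω then (1 : ℝ) else 0)] ≤
      (2 / D) * ((∑ i : Fin d, x i ^ 2) * (∑ i : Fin d, y i ^ 2)) := by
  classical
  have hsq : ∀ i ω, s i ω * s i ω = 1 := fun i ω => by
    rcases hsign i ω with h | h <;> simp [h]
  have habs : ∀ i ω, |s i ω| = 1 := fun i ω => by
    rcases hsign i ω with h | h <;> simp [h]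
  let c : Fin d × Fin d → Ω → ℝ := fun p ω => if h p.1 ω = h p.2 ω then 1 else 0
  let g : Fin d × Fin d → Ω → ℝ := fun p ω => s p.1 ω * s p.2 ω * c p ω
  let a : Fin d × Fin d → ℝ := fun p => x p.1 * y p.2
  let T : Ω → ℝ := fun ω => ∑ p ∈ (univ : Finset (Fin d)).offDiag, a p * g p ω
  have hcmeas : ∀ p, Measurable (c p) := fun p =>
    Measurable.ite (measurableSet_eq_fun (hhmeas _) (hhmeas _)) measurable_const measurable_const
  have hgmeas : ∀ p, Measurable (g p) := fun p =>
    ((hsmeas _).mul (hsmeas _)).mul (hcmeas p)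
  have hgle : ∀ p ω, |g p ω| ≤ 1 := fun p ω => by
    simp only [g, c, abs_mul, habs]
    split_ifs <;> simp
  have hTmeas : Measurable T := by
    refine Finset.measurable_fun_sum _ fun p _ => (hgmeas p).const_mul _
  have hdecomp : (fun ω => ∑ i : Fin d, ∑ j : Fin d,
      x i * y j * s i ω * s j ω * (if h i ω = h j ω then (1 : ℝ) else 0)) =
      fun ω => T ω + ∑ i, x i * y i := by
    funext ω
    have e : ∑ i : Fin d, ∑ j : Fin d,
        x i * y j * s i ω * s j ω * (if h i ω = h j ω then (1 : ℝ) else 0) =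
        ∑ p : Fin d × Fin d, a p * g p ω := by
      rw [Fintype.sum_prod_type]
      refine sum_congr rfl fun i _ => sum_congr rfl fun j _ => ?_
      simp only [a, g, c]
      ring
    have hdiag : ∑ p ∈ (univ : Finset (Fin d)).diag, a p * g p ω = ∑ i, x i * y i := by
      rw [sum_diag]
      refine sum_congr rfl fun i _ => ?_
      simp [a, g, c, hsq]
    rw [e, ← univ_product_univ, ← diag_union_offDiag, sum_union (disjoint_diag_offDiag _),
      hdiag, add_comm]
  have hcint : ∀ p : Fin d × Fin d, p.1 ≠ p.2 → ∫ ω, c p ω ∂ℙ = 1 / (D : ℝ) := by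
    intro p hp
    have hc : c p = Set.indicator {ω | h p.1 ω = h p.2 ω} 1 := by
      funext ω
      simp [c, Set.indicator_apply]
    rw [hc, integral_indicator_one (measurableSet_eq_fun (hhmeas _) (hhmeas _)),
      measureReal_def, hh _ _ hp]
    simp
  have hgint : ∀ p q, Integrable (fun ω => g p ω * g q ω) ℙ := fun p q =>
    Integrable.of_bound ((hgmeas p).mul (hgmeas q)).aestronglyMeasurable 1
      (Filter.Eventually.of_forall fun ω => by
        rw [Real.norm_eq_abs, abs_mul]
        exact mul_le_one₀ (hgle p ω) (abs_nonneg _) (hgle q ω))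
  have hcov : ∀ p ∈ (univ : Finset (Fin d)).offDiag, ∀ q ∈ (univ : Finset (Fin d)).offDiag,
      ∫ ω, g p ω * g q ω ∂ℙ =
        (if q = p then 1 / (D : ℝ) else 0) + (if q = p.swap then 1 / (D : ℝ) else 0) := by
    rintro ⟨i, j⟩ hp ⟨k, l⟩ hq
    have hij : i ≠ j := by simpa using hp
    have hkl : k ≠ l := by simpa using hq
    by_cases h₁ : k = i ∧ l = j
    · obtain ⟨rfl, rfl⟩ := h₁
      rw [if_pos rfl, if_neg (by simp [hkl]), add_zero, ← hcint (k, l) hkl]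
      congr 1 with ω
      simp only [g, c]
      split_ifs
      · linear_combination (s l ω * s l ω) * hsq k ω + hsq l ω
      · simp
    by_cases h₂ : k = j ∧ l = i
    · obtain ⟨rfl, rfl⟩ := h₂
      rw [if_neg (by simp [hkl]), if_pos Prod.swap_prod_mk.symm, zero_add, ← hcint (k, l) hkl]
      congr 1 with ω
      simp only [g, c, eq_comm (a := h l ω)]
      split_ifs
      · linear_combination (s l ω * s l ω) * hsq k ω + hsq l ω
      · simp
    have hzero := integral_sign_mul_eq_zero hsign hs2 hs4 hij hkl h₁ h₂
    have hφ : Measurable fun v : Fin d → ℝ => v i * v j * v k * v l := by fun_prop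
    have hψ : Measurable fun v : Fin d → Fin D =>
        (if v i = v j then (1 : ℝ) else 0) * (if v k = v l then (1 : ℝ) else 0) :=
      measurable_of_countable _
    have hprod := (hindep.comp hφ hψ).integral_fun_mul_eq_mul_integral
      (hφ.comp (measurable_pi_lambda _ hsmeas)).aestronglyMeasurable
      (hψ.comp (measurable_pi_lambda _ hhmeas)).aestronglyMeasurable
    simp only [Function.comp_apply] at hprod
    rw [hzero, zero_mul] at hprod
    rw [if_neg (by simpa using h₁), if_neg (by simpa using h₂), add_zero, ← hprod]
    congr 1 with ω
    simp only [g, c]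
    ring
  have hsecond : ∫ ω, T ω ^ 2 ∂ℙ =
      (1 / D) * ∑ p ∈ (univ : Finset (Fin d)).offDiag, (a p ^ 2 + a p * a p.swap) := by
    have hexp : ∀ ω, T ω ^ 2 = ∑ p ∈ (univ : Finset (Fin d)).offDiag,
        ∑ q ∈ (univ : Finset (Fin d)).offDiag, a p * a q * (g p ω * g q ω) := fun ω => by
      simp only [T, sq, sum_mul_sum]
      refine sum_congr rfl fun p _ => sum_congr rfl fun q _ => by ring
    simp only [hexp]
    rw [integral_finsetSum _ fun p _ => integrable_finsetSum _ fun q _ =>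
      (hgint p q).const_mul _, mul_sum]
    refine sum_congr rfl fun p hp => ?_
    rw [integral_finsetSum _ fun q _ => (hgint p q).const_mul _]
    have hswap : p.swap ∈ (univ : Finset (Fin d)).offDiag := by
      simpa [eq_comm] using hp
    rw [sum_congr rfl fun q hq => by rw [integral_const_mul, hcov p hp q hq]]
    simp only [mul_add, mul_ite, mul_zero, sum_add_distrib, sum_ite_eq', hp, hswap, if_true]
    ring
  rw [hdecomp, variance_add_const hTmeas.aestronglyMeasurable]
  calc
    Var[T] ≤ ∫ ω, T ω ^ 2 ∂ℙ := variance_le_expectation_sq hTmeas.aestronglyMeasurable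
    _ = (1 / D) * ∑ p ∈ (univ : Finset (Fin d)).offDiag, (a p ^ 2 + a p * a p.swap) := hsecond
    _ ≤ (1 / D) * (2 * ((∑ i, x i ^ 2) * ∑ i, y i ^ 2)) := by
      gcongr
      exact sum_offDiag_sq_add_mul_swap_le x y
    _ = (2 / D) * ((∑ i, x i ^ 2) * ∑ i, y i ^ 2) := by ring
end

section
/- Fix any functions h₁, h₂ : [d] → ZMod D and s₁, s₂ : [d] → {−1, 1}, and define H(i₁, i₂) = h₁(i₁) + h₂(i₂) (in ZMod D) and S(i₁, i₂) = s₁(i₁)s₂(i₂). Then for every x ∈ ℝ^d and every k ∈ ZMod D, the cyclic convolution of the two Count Sketches equals the Count Sketch of the tensor product x ⊗ x under (H, S): ∑_{a, b ∈ ZMod D, a + b = k} (∑_{i : h₁(i) = a} s₁(i) x_i)(∑_{i : h₂(i) = b} s₂(i) x_i) = ∑_{(i₁, i₂) ∈ [d]² : H(i₁, i₂) = k} S(i₁, i₂) x_{i₁} x_{i₂}. -/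
open Finset

/-- **Convolution of Count Sketches equals the Count Sketch of the tensor
product** (deterministic identity underlying the FFT computation). For any
bucket hashes `h₁ h₂ : [d] → ZMod D`, sign hashes `s₁ s₂ : [d] → {−1,1}`, and
composite hashes `H(i₁,i₂) = h₁ i₁ + h₂ i₂`, `S(i₁,i₂) = s₁ i₁ * s₂ i₂`, the
cyclic convolution of the two Count Sketches of `x` is the Count Sketch of
`x ⊗ x` under `(H, S)`. -/
theorem count_sketch_convolution (d D : ℕ) [NeZero D] (x : Fin d → ℝ)
    (h₁ h₂ : Fin d → ZMod D) (s₁ s₂ : Fin d → ℝ)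
    (hs₁ : ∀ i, s₁ i = 1 ∨ s₁ i = -1) (hs₂ : ∀ i, s₂ i = 1 ∨ s₂ i = -1)
    (k : ZMod D) :
    ∑ a : ZMod D, ∑ b : ZMod D,
        (if a + b = k then
          (∑ i ∈ Finset.univ.filter fun i => h₁ i = a, s₁ i * x i) *
            (∑ i ∈ Finset.univ.filter fun i => h₂ i = b, s₂ i * x i)
        else 0) =
      ∑ i₁ : Fin d, ∑ i₂ : Fin d,
        if h₁ i₁ + h₂ i₂ = k then (s₁ i₁ * s₂ i₂) * (x i₁ * x i₂) else 0 := by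
  rw [← Finset.sum_fiberwise Finset.univ h₁]
  refine Finset.sum_congr rfl fun a _ => ?_
  simp_rw [← Finset.sum_fiberwise Finset.univ h₂ fun i₂ => ite (_ + h₂ i₂ = k) _ _]
  rw [Finset.sum_comm]
  refine Finset.sum_congr rfl fun b _ => ?_
  have fiber_eq : ∀ i₁ ∈ Finset.univ.filter (fun i => h₁ i = a),
      ∀ i₂ ∈ Finset.univ.filter (fun i => h₂ i = b),
      (if h₁ i₁ + h₂ i₂ = k then (s₁ i₁ * s₂ i₂) * (x i₁ * x i₂) else 0) =
        if a + b = k then (s₁ i₁ * x i₁) * (s₂ i₂ * x i₂) else 0 := by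
    intro i₁ hi₁ i₂ hi₂
    rw [(Finset.mem_filter.mp hi₁).2, (Finset.mem_filter.mp hi₂).2, mul_mul_mul_comm]
  rw [Finset.sum_congr rfl fun i₁ hi₁ => Finset.sum_congr rfl (fiber_eq i₁ hi₁),
    Finset.sum_mul_sum]
  split_ifs <;> simp
end
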